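/- Let q, m, l be integers with q ≥ 2 and m ≥ l. (Even case) If l ≥ 2 and (m+l)! · l! · (q² − 1) > (m+1)! · (2l−1)! · (q^{2l} − 1), then the system U(2m, m−l, q) has no solution. (Odd case) If l ≥ 1 and (m+l+1)! · l! · (q − 1) > (m+1)! · (2l)! · (q^{2l+1} − 1), then the system U(2m+1, m−l, q) has no solution. -/

import Mathlib

open Finset

/-- Feasibility of the linear system `U(n,k,q)` from the paper:
real variables `x_{k+1}, …, x_n` with
`x_i ≥ 0` for `i ∈ [k+1, n]`;
`∑_{j=k+1}^{i} C(n−j, i−j)·x_j ≥ 0` for `i ∈ [k+1, ⌊n/2⌋]`;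
`∑_{j=k+1}^{i} C(n−j, i−j)·x_j ≥ (q^{2i−n} − 1)·C(n, i)` for `i ∈ [⌊n/2⌋+1, n−k−1]`;
`∑_{j=k+1}^{i} C(n−j, i−j)·x_j = (q^{2i−n} − 1)·C(n, i)` for `i ∈ [n−k, n]`. -/
def UFeasible (n k q : ℕ) : Prop :=
  ∃ x : ℕ → ℝ,
    (∀ i, k + 1 ≤ i → i ≤ n → 0 ≤ x i) ∧
    (∀ i, k + 1 ≤ i → i ≤ n / 2 →
      0 ≤ ∑ j ∈ Finset.Icc (k + 1) i, ((n - j).choose (i - j) : ℝ) * x j) ∧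
    (∀ i, n / 2 + 1 ≤ i → i ≤ n - k - 1 →
      ((q : ℝ) ^ (2 * i - n) - 1) * (n.choose i : ℝ) ≤
        ∑ j ∈ Finset.Icc (k + 1) i, ((n - j).choose (i - j) : ℝ) * x j) ∧
    (∀ i, n - k ≤ i → i ≤ n →
      ∑ j ∈ Finset.Icc (k + 1) i, ((n - j).choose (i - j) : ℝ) * x j =
        ((q : ℝ) ^ (2 * i - n) - 1) * (n.choose i : ℝ))

theorem choose_mul_sum_choose_le (n k a b : ℕ) (hab : a ≤ b) (hbn : b ≤ n)
    (x : ℕ → ℝ) (hx : ∀ i, k + 1 ≤ i → i ≤ n → 0 ≤ x i) :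
    ((n - a).choose (b - a) : ℝ) *
        ∑ j ∈ Icc (k + 1) a, ((n - j).choose (a - j) : ℝ) * x j ≤
      ((b - k - 1).choose (b - a) : ℝ) *
        ∑ j ∈ Icc (k + 1) b, ((n - j).choose (b - j) : ℝ) * x j := by
  rw [mul_sum, mul_sum]
  calc ∑ j ∈ Icc (k + 1) a, ((n - a).choose (b - a) : ℝ) * (((n - j).choose (a - j) : ℝ) * x j)
      ≤ ∑ j ∈ Icc (k + 1) a,
          ((b - k - 1).choose (b - a) : ℝ) * (((n - j).choose (b - j) : ℝ) * x j) := by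
        refine sum_le_sum fun j hj => ?_
        obtain ⟨hkj, hja⟩ := mem_Icc.mp hj
        have hmul : (n - j).choose (b - j) * (b - j).choose (a - j) =
            (n - j).choose (a - j) * (n - a).choose (b - a) := by
          rw [Nat.choose_mul (by omega), show n - j - (a - j) = n - a by omega,
            show b - j - (a - j) = b - a by omega]
        have hle : (b - j).choose (a - j) ≤ (b - k - 1).choose (b - a) := by
          rw [← Nat.choose_symm_of_eq_add (show b - j = (b - a) + (a - j) by omega)]
          exact Nat.choose_le_choose _ (by omega)
        have hfin : (n - a).choose (b - a) * (n - j).choose (a - j) ≤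
            (b - k - 1).choose (b - a) * (n - j).choose (b - j) := by
          rw [mul_comm, ← hmul, mul_comm]
          exact Nat.mul_le_mul_right _ hle
        rw [← mul_assoc, ← mul_assoc]
        exact mul_le_mul_of_nonneg_right (mod_cast hfin) (hx j hkj (by omega))
    _ ≤ _ := by
        refine sum_le_sum_of_subset_of_nonneg (Icc_subset_Icc_right hab) fun j hj _ => ?_
        obtain ⟨hkj, hjb⟩ := mem_Icc.mp hj
        have := hx j hkj (by omega)
        positivity

theorem UFeasible.choose_mul_pow_sub_one_le {n k q a b : ℕ} (h : UFeasible n k q) (hq : 1 ≤ q)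
    (ha : n / 2 + 1 ≤ a) (ha' : a ≤ n - k - 1) (hb : n - k ≤ b) (hbn : b ≤ n) :
    b.choose a * (q ^ (2 * a - n) - 1) ≤ (b - k - 1).choose (b - a) * (q ^ (2 * b - n) - 1) := by
  obtain ⟨x, hx, -, hlow, heq⟩ := h
  have hab : a ≤ b := by omega
  have hsum := choose_mul_sum_choose_le n k a b hab hbn x hx
  rw [heq b hb hbn] at hsum
  have hS := (mul_le_mul_of_nonneg_left (hlow a ha ha')
    (Nat.cast_nonneg ((n - a).choose (b - a)))).trans hsum
  have hpos : (0 : ℝ) < n.choose b := mod_cast Nat.choose_pos hbn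
  have hmul : (n.choose b : ℝ) * b.choose a = n.choose a * (n - a).choose (b - a) :=
    mod_cast Nat.choose_mul hab
  rw [← Nat.cast_le (α := ℝ)]
  push_cast [Nat.one_le_pow _ q hq]
  refine le_of_mul_le_mul_left ?_ hpos
  linear_combination hS + ((q : ℝ) ^ (2 * a - n) - 1) * hmul

/-- Corollary 9 of the paper: nonexistence of AME states of defect `l`
(i.e. infeasibility of `U(n, ⌊n/2⌋ − l, q)`) under a factorial inequality,
for `n = 2m` (even case, `l ≥ 2`) and `n = 2m+1` (odd case, `l ≥ 1`). -/
theorem stmt_2 (q m l : ℕ) (hq : 2 ≤ q) (hml : l ≤ m) :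
    (2 ≤ l →
      (m + l).factorial * l.factorial * (q ^ 2 - 1) >
        (m + 1).factorial * (2 * l - 1).factorial * (q ^ (2 * l) - 1) →
      ¬ UFeasible (2 * m) (m - l) q) ∧
    (1 ≤ l →
      (m + l + 1).factorial * l.factorial * (q - 1) >
        (m + 1).factorial * (2 * l).factorial * (q ^ (2 * l + 1) - 1) →
      ¬ UFeasible (2 * m + 1) (m - l) q) := by
  constructor
  · intro hl h hU
    have hle := hU.choose_mul_pow_sub_one_le (a := m + 1) (b := m + l) (by omega) (by omega)
      (by omega) (by omega) (by omega)
    rw [show 2 * (m + 1) - 2 * m = 2 by omega, show 2 * (m + l) - 2 * m = 2 * l by omega,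
      show m + l - (m - l) - 1 = 2 * l - 1 by omega, show m + l - (m + 1) = l - 1 by omega] at hle
    have h₁ := Nat.choose_mul_factorial_mul_factorial (show m + 1 ≤ m + l by omega)
    have h₂ := Nat.choose_mul_factorial_mul_factorial (show l - 1 ≤ 2 * l - 1 by omega)
    rw [show m + l - (m + 1) = l - 1 by omega] at h₁
    rw [show 2 * l - 1 - (l - 1) = l by omega] at h₂
    refine absurd h (not_lt.mpr ?_)
    rw [← h₁, ← h₂]
    refine le_of_eq_of_le ?_ ((Nat.mul_le_mul_left
      ((m + 1).factorial * (l - 1).factorial * l.factorial) hle).trans_eq ?_) <;> ring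
  · intro hl h hU
    have hle := hU.choose_mul_pow_sub_one_le (a := m + 1) (b := m + l + 1) (by omega) (by omega)
      (by omega) (by omega) (by omega)
    rw [show 2 * (m + 1) - (2 * m + 1) = 1 by omega,
      show 2 * (m + l + 1) - (2 * m + 1) = 2 * l + 1 by omega,
      show m + l + 1 - (m - l) - 1 = 2 * l by omega, show m + l + 1 - (m + 1) = l by omega,
      pow_one] at hle
    have h₁ := Nat.choose_mul_factorial_mul_factorial (show m + 1 ≤ m + l + 1 by omega)
    have h₂ := Nat.choose_mul_factorial_mul_factorial (show l ≤ 2 * l by omega)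
    rw [show m + l + 1 - (m + 1) = l by omega] at h₁
    rw [show 2 * l - l = l by omega] at h₂
    refine absurd h (not_lt.mpr ?_)
    rw [← h₁, ← h₂]
    refine le_of_eq_of_le ?_ ((Nat.mul_le_mul_left
      ((m + 1).factorial * l.factorial * l.factorial) hle).trans_eq ?_) <;> ring
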